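/- Consider the instance with nine items e_1,…,e_9 and three agents R, C, U with additive valuations given item by item (listed in the order e_1,…,e_9) by: v^R = (0, 6, 6, 10, 1, 1, 4, 4, 4); v^C = (0, 22/3, 20/3, 25/3, 1, 5/3, 11/3, 11/3, 11/3); v^U = (0, 22/3, 22/3, 31/3, 0, 0, 11/3, 11/3, 11/3). Then MMS^R = MMS^C = 12 and PS^U = 12, and in every allocation of the nine items into three bundles (A_R, A_C, A_U), at least one of the following holds: v^R(A_R) ≤ 11, or v^C(A_C) ≤ 11, or v^U(A_U) ≤ 11. -/

import Mathlib

/-- The total value of the bundle given to agent `j` by allocation/partition `f`. -/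
noncomputable def bundleVal {M : Type*} [Fintype M] {n : ℕ} (v : M → ℝ)
    (f : M → Fin n) (j : Fin n) : ℝ :=
  ∑ e ∈ Finset.univ.filter (fun e => f e = j), v e

/-- The maximin share: max over partitions into `n` bundles of the min bundle value. -/
noncomputable def MMS {M : Type*} [Fintype M] [DecidableEq M] (n : ℕ) [NeZero n]
    (v : M → ℝ) : ℝ :=
  Finset.univ.sup' Finset.univ_nonempty fun f : M → Fin n =>
    Finset.univ.inf' Finset.univ_nonempty fun j => bundleVal v f j

/-- The minimax share: min over partitions into `n` bundles of the max bundle value. -/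
noncomputable def mmS {M : Type*} [Fintype M] [DecidableEq M] (n : ℕ) [NeZero n]
    (v : M → ℝ) : ℝ :=
  Finset.univ.inf' Finset.univ_nonempty fun f : M → Fin n =>
    Finset.univ.sup' Finset.univ_nonempty fun j => bundleVal v f j

/-- The proportional share: total value divided by the number `n` of agents. -/
noncomputable def PS {M : Type*} [Fintype M] (n : ℕ) (v : M → ℝ) : ℝ :=
  (∑ e, v e) / n

/-- Valuation of agent R in the negative example for goods. -/
noncomputable def vR : Fin 9 → ℝ := ![0, 6, 6, 10, 1, 1, 4, 4, 4]

/-- Valuation of agent C in the negative example for goods. -/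
noncomputable def vC : Fin 9 → ℝ := ![0, 22/3, 20/3, 25/3, 1, 5/3, 11/3, 11/3, 11/3]

/-- Valuation of agent U in the negative example for goods. -/
noncomputable def vU : Fin 9 → ℝ := ![0, 22/3, 22/3, 31/3, 0, 0, 11/3, 11/3, 11/3]

theorem bundleVal_eq_sum_ite {M : Type*} [Fintype M] {n : ℕ} (v : M → ℝ) (f : M → Fin n)
    (j : Fin n) : bundleVal v f j = ∑ e, if f e = j then v e else 0 :=
  Finset.sum_filter _ _

theorem sum_bundleVal {M : Type*} [Fintype M] {n : ℕ} (v : M → ℝ) (f : M → Fin n) :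
    ∑ j, bundleVal v f j = ∑ e, v e :=
  Finset.sum_fiberwise _ _ _

theorem MMS_le_PS {M : Type*} [Fintype M] [DecidableEq M] (n : ℕ) [NeZero n] (v : M → ℝ) :
    MMS n v ≤ PS n v := by
  have hn : (0 : ℝ) < n := Nat.cast_pos.mpr (NeZero.pos n)
  refine Finset.sup'_le _ _ fun f _ => ?_
  rw [PS, le_div_iff₀ hn, ← sum_bundleVal v f, mul_comm]
  simpa using Finset.card_nsmul_le_sum Finset.univ (bundleVal v f) _
    fun j hj => Finset.inf'_le (bundleVal v f) hj

theorem le_MMS {M : Type*} [Fintype M] [DecidableEq M] {n : ℕ} [NeZero n] {v : M → ℝ} {c : ℝ}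
    (f : M → Fin n) (h : ∀ j, c ≤ bundleVal v f j) : c ≤ MMS n v :=
  (Finset.le_inf' _ _ fun j _ => h j).trans
    (Finset.le_sup' (fun f : M → Fin n =>
      Finset.univ.inf' Finset.univ_nonempty fun j => bundleVal v f j) (Finset.mem_univ f))

theorem PS_vR : PS 3 vR = 12 := by
  norm_num [PS, vR, Fin.sum_univ_succ]

theorem PS_vC : PS 3 vC = 12 := by
  norm_num [PS, vC, Fin.sum_univ_succ]

theorem PS_vU : PS 3 vU = 12 := by
  norm_num [PS, vU, Fin.sum_univ_succ]

theorem MMS_vR : MMS 3 vR = 12 := by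
  refine le_antisymm (PS_vR ▸ MMS_le_PS 3 vR) (le_MMS ![0, 0, 0, 1, 1, 1, 2, 2, 2] fun j => ?_)
  rw [bundleVal_eq_sum_ite]
  fin_cases j <;> norm_num +decide [vR, Fin.sum_univ_succ]

theorem MMS_vC : MMS 3 vC = 12 := by
  refine le_antisymm (PS_vC ▸ MMS_le_PS 3 vC) (le_MMS ![0, 0, 1, 2, 0, 1, 0, 1, 2] fun j => ?_)
  rw [bundleVal_eq_sum_ite]
  fin_cases j <;> norm_num +decide [vC, Fin.sum_univ_succ]

/-- The total weight `∑ w i` over the eight items with `x i = j`. -/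
def assignedWeight (w₁ w₂ w₃ w₄ w₅ w₆ w₇ w₈ : ℕ) (j x₁ x₂ x₃ x₄ x₅ x₆ x₇ x₈ : Fin 3) : ℕ :=
  (if x₁ = j then w₁ else 0) + (if x₂ = j then w₂ else 0) + (if x₃ = j then w₃ else 0) +
  (if x₄ = j then w₄ else 0) + (if x₅ = j then w₅ else 0) + (if x₆ = j then w₆ else 0) +
  (if x₇ = j then w₇ else 0) + (if x₈ = j then w₈ else 0)

/-- All valuations are scaled by three and the worthless first item is left out. -/
theorem assignedWeight_le : ∀ x₁ x₂ x₃ x₄ x₅ x₆ x₇ x₈ : Fin 3,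
    assignedWeight 18 18 30 3 3 12 12 12 0 x₁ x₂ x₃ x₄ x₅ x₆ x₇ x₈ ≤ 33 ∨
    assignedWeight 22 20 25 3 5 11 11 11 1 x₁ x₂ x₃ x₄ x₅ x₆ x₇ x₈ ≤ 33 ∨
    assignedWeight 22 22 31 0 0 11 11 11 2 x₁ x₂ x₃ x₄ x₅ x₆ x₇ x₈ ≤ 33 := by
  decide +kernel

theorem bundleVal_le_of_assignedWeight_le {w₁ w₂ w₃ w₄ w₅ w₆ w₇ w₈ : ℕ} {v : Fin 9 → ℝ}
    (hv : v = ![0, (w₁ : ℝ) / 3, (w₂ : ℝ) / 3, (w₃ : ℝ) / 3, (w₄ : ℝ) / 3, (w₅ : ℝ) / 3, (w₆ : ℝ) / 3,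
      (w₇ : ℝ) / 3, (w₈ : ℝ) / 3])
    {A : Fin 9 → Fin 3} {j : Fin 3}
    (h : assignedWeight w₁ w₂ w₃ w₄ w₅ w₆ w₇ w₈ j
      (A 1) (A 2) (A 3) (A 4) (A 5) (A 6) (A 7) (A 8) ≤ 33) :
    bundleVal v A j ≤ 11 := by
  have h' : bundleVal v A j = (assignedWeight w₁ w₂ w₃ w₄ w₅ w₆ w₇ w₈ j
      (A 1) (A 2) (A 3) (A 4) (A 5) (A 6) (A 7) (A 8) : ℝ) / 3 := by
    rw [bundleVal_eq_sum_ite, hv]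
    simp [Fin.sum_univ_castSucc, assignedWeight, add_div, ite_div]
  rw [h', div_le_iff₀ three_pos]
  exact (Nat.cast_le.mpr h).trans (by norm_num)

/-- In the nine-item instance with valuations vR, vC, vU, the maximin
shares of R and C equal 12, the proportional share of U equals 12, and in every
allocation (agent R = 0, C = 1, U = 2) some agent gets a bundle of value at most 11. -/
theorem negative_example_goods :
    MMS 3 vR = 12 ∧ MMS 3 vC = 12 ∧ PS 3 vU = 12 ∧
    ∀ A : Fin 9 → Fin 3,
      bundleVal vR A 0 ≤ 11 ∨ bundleVal vC A 1 ≤ 11 ∨ bundleVal vU A 2 ≤ 11 := by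
  refine ⟨MMS_vR, MMS_vC, PS_vU, fun A => ?_⟩
  refine (assignedWeight_le (A 1) (A 2) (A 3) (A 4) (A 5) (A 6) (A 7) (A 8)).imp
    (bundleVal_le_of_assignedWeight_le ?_)
    (Or.imp (bundleVal_le_of_assignedWeight_le ?_) (bundleVal_le_of_assignedWeight_le ?_))
  · norm_num [vR]
  · norm_num [vC]
  · norm_num [vU]
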